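/- Let c₀ ≤ 0, c₁ ∈ ℝ₊ⁿ, and let μ be a positive (Radon) measure on ℝ₊ⁿ∖{0} such that for sufficiently small δ > 0 the functions u ↦ u_j are μ-integrable on [0,δ)ⁿ∖{0} for each j = 1,…,n and μ(ℝ₊ⁿ∖[0,δ)ⁿ) < ∞. Then the function ψ(s) = c₀ + c₁·s + ∫_{ℝ₊ⁿ∖{0}} (e^{s·u} − 1) dμ(u), s ∈ (−∞,0)ⁿ, is well defined (the integral converges) and belongs to the class T_n. -/

import Mathlib

open MeasureTheory Filter Set

noncomputable section

/-- The open negative orthant `(-∞,0)^n`. -/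
def negOrthant (n : ℕ) : Set (Fin n → ℝ) := {s | ∀ i, s i < 0}

/-- `f` is absolutely monotone on `(-∞,0)^n`: it is `C^∞` there and all its
iterated partial derivatives (of all orders, including order `0`) are nonnegative. -/
def AbsMono (n : ℕ) (f : (Fin n → ℝ) → ℝ) : Prop :=
  ContDiffOn ℝ (⊤ : ℕ∞) f (negOrthant n) ∧
  ∀ (k : ℕ) (m : Fin k → Fin n), ∀ x ∈ negOrthant n,
    0 ≤ iteratedFDerivWithin ℝ k f (negOrthant n) x (fun i => Pi.single (m i) 1)

/-- `ψ` belongs to the class `T_n`: it is a nonpositive `C^∞` function on `(-∞,0)^n`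
all of whose partial derivatives of every order `≥ 1` are nonnegative. -/
def MemT (n : ℕ) (ψ : (Fin n → ℝ) → ℝ) : Prop :=
  ContDiffOn ℝ (⊤ : ℕ∞) ψ (negOrthant n) ∧
  (∀ x ∈ negOrthant n, ψ x ≤ 0) ∧
  ∀ (k : ℕ) (m : Fin (k + 1) → Fin n), ∀ x ∈ negOrthant n,
    0 ≤ iteratedFDerivWithin ℝ (k + 1) ψ (negOrthant n) x (fun i => Pi.single (m i) 1)

/-- `ℝ₊ⁿ ∖ {0}`. -/
def posPart (n : ℕ) : Set (Fin n → ℝ) := {u | (∀ i, 0 ≤ u i) ∧ u ≠ 0}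

/-- `[0,δ)ⁿ ∖ {0}`. -/
def smallBox (n : ℕ) (δ : ℝ) : Set (Fin n → ℝ) := {u | (∀ i, 0 ≤ u i ∧ u i < δ) ∧ u ≠ 0}

/-- `ℝ₊ⁿ ∖ [0,δ)ⁿ`. -/
def farPart (n : ℕ) (δ : ℝ) : Set (Fin n → ℝ) := {u | (∀ i, 0 ≤ u i) ∧ ¬ ∀ i, u i < δ}

/-- The conditions on the representing measure: for sufficiently small `δ > 0`,
the coordinate functions are integrable on `[0,δ)ⁿ ∖ {0}` and
`μ(ℝ₊ⁿ ∖ [0,δ)ⁿ) < ∞`. -/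
def GoodMeasure (n : ℕ) (μ : Measure (Fin n → ℝ)) : Prop :=
  ∃ δ > (0:ℝ), (∀ j, IntegrableOn (fun u => u j) (smallBox n δ) μ) ∧ μ (farPart n δ) < ⊤

section

open scoped Topology

variable {n : ℕ}

lemma isOpen_negOrthant : IsOpen (negOrthant n) := by
  simp only [negOrthant, ofPred_forall]
  exact isOpen_iInter_of_finite fun i => isOpen_lt (continuous_apply i) continuous_const

lemma measurableSet_posPart : MeasurableSet (posPart n) := by
  refine MeasurableSet.inter (s₁ := {u : Fin n → ℝ | ∀ i, 0 ≤ u i}) (s₂ := {u | u ≠ 0}) ?_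
    (measurableSet_singleton 0).compl
  simp only [ofPred_forall]
  exact MeasurableSet.iInter fun i => measurableSet_le measurable_const (measurable_pi_apply i)

lemma measurableSet_smallBox (δ : ℝ) : MeasurableSet (smallBox n δ) := by
  refine MeasurableSet.inter (s₁ := {u : Fin n → ℝ | ∀ i, 0 ≤ u i ∧ u i < δ}) (s₂ := {u | u ≠ 0}) ?_
    (measurableSet_singleton 0).compl
  simp only [ofPred_forall]
  exact MeasurableSet.iInter fun i =>
    (measurableSet_le measurable_const (measurable_pi_apply i)).inter
      (measurableSet_lt (measurable_pi_apply i) measurable_const)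

lemma measurableSet_farPart (δ : ℝ) : MeasurableSet (farPart n δ) := by
  refine MeasurableSet.inter (s₁ := {u : Fin n → ℝ | ∀ i, 0 ≤ u i})
    (s₂ := {u : Fin n → ℝ | ∀ i, u i < δ}ᶜ) ?_ (MeasurableSet.compl ?_)
  · simp only [ofPred_forall]
    exact MeasurableSet.iInter fun i => measurableSet_le measurable_const (measurable_pi_apply i)
  · simp only [ofPred_forall]
    exact MeasurableSet.iInter fun i => measurableSet_lt (measurable_pi_apply i) measurable_const

lemma posPart_subset (δ : ℝ) : posPart n ⊆ smallBox n δ ∪ farPart n δ := by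
  rintro u ⟨hu, hu0⟩
  by_cases h : ∀ i, u i < δ
  · exact Or.inl ⟨fun i => ⟨hu i, h i⟩, hu0⟩
  · exact Or.inr ⟨hu, h⟩

/-- The function `min 1 (∑ i, u i)` dominates, up to a constant, all integrands of interest. -/
lemma GoodMeasure.integrableOn_min {μ : Measure (Fin n → ℝ)} (hμ : GoodMeasure n μ) :
    IntegrableOn (fun u => min 1 (∑ i, u i)) (posPart n) μ := by
  obtain ⟨δ, -, hsmall, hfar⟩ := hμ
  have hmeas : Measurable fun u : Fin n → ℝ => min 1 (∑ i, u i) := by fun_prop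
  refine IntegrableOn.mono_set (IntegrableOn.union ?_ ?_) (posPart_subset δ)
  · refine Integrable.mono' (integrable_finsetSum Finset.univ fun j _ => hsmall j)
      hmeas.aestronglyMeasurable ?_
    filter_upwards [ae_restrict_mem (measurableSet_smallBox δ)] with u hu
    have h0 : 0 ≤ ∑ i, u i := Finset.sum_nonneg fun i _ => (hu.1 i).1
    rw [Real.norm_of_nonneg (le_min zero_le_one h0)]
    exact min_le_right _ _
  · refine Measure.integrableOn_of_bounded (M := 1) hfar.ne hmeas.aestronglyMeasurable ?_
    filter_upwards [ae_restrict_mem (measurableSet_farPart δ)] with u hu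
    have h0 : 0 ≤ ∑ i, u i := Finset.sum_nonneg fun i _ => hu.1 i
    rw [Real.norm_of_nonneg (le_min zero_le_one h0)]
    exact min_le_left _ _

/-- The monomial `∏_{j ∈ l} u_j`. -/
def monom (l : List (Fin n)) (u : Fin n → ℝ) : ℝ := (l.map u).prod

@[simp] lemma monom_nil (u : Fin n → ℝ) : monom [] u = 1 := rfl

@[simp] lemma monom_cons (j : Fin n) (l : List (Fin n)) (u : Fin n → ℝ) :
    monom (j :: l) u = u j * monom l u := by simp [monom]

@[fun_prop] lemma continuous_monom (l : List (Fin n)) : Continuous (monom l) := by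
  induction l with
  | nil => exact continuous_const
  | cons j l ih =>
    rw [funext (monom_cons j l)]
    exact (continuous_apply j).mul ih

lemma monom_nonneg (l : List (Fin n)) {u : Fin n → ℝ} (hu : ∀ i, 0 ≤ u i) : 0 ≤ monom l u := by
  induction l with
  | nil => exact zero_le_one
  | cons j l ih => simpa using mul_nonneg (hu j) ih

lemma monom_le (l : List (Fin n)) {u : Fin n → ℝ} (hu : ∀ i, 0 ≤ u i) :
    monom l u ≤ (∑ i, u i) ^ l.length := by
  induction l with
  | nil => simp
  | cons j l ih =>
    rw [monom_cons, List.length_cons, pow_succ']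
    exact mul_le_mul (Finset.single_le_sum (fun i _ => hu i) (Finset.mem_univ j)) ih
      (monom_nonneg l hu) (Finset.sum_nonneg fun i _ => hu i)

lemma pow_mul_exp_neg_le {ε t : ℝ} (hε : 0 < ε) (ht : 0 ≤ t) (k : ℕ) :
    t ^ k * Real.exp (-ε * t) ≤ k.factorial / ε ^ k := by
  have h := Real.pow_div_factorial_le_exp (ε * t) (by positivity) k
  rw [neg_mul, Real.exp_neg, ← div_eq_mul_inv, div_le_div_iff₀ (Real.exp_pos _) (by positivity)]
  rw [div_le_iff₀ (by positivity), mul_pow] at h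
  linarith

lemma GoodMeasure.integrableOn_monom_mul_exp_neg {μ : Measure (Fin n → ℝ)} (hμ : GoodMeasure n μ)
    (l : List (Fin n)) (hl : l ≠ []) {ε : ℝ} (hε : 0 < ε) :
    IntegrableOn (fun u => monom l u * Real.exp (-ε * ∑ i, u i)) (posPart n) μ := by
  obtain ⟨j, l, rfl⟩ := List.exists_cons_of_ne_nil hl
  set A : ℝ := (l.length + 1).factorial / ε ^ (l.length + 1)
  set B : ℝ := l.length.factorial / ε ^ l.length
  refine Integrable.mono' (hμ.integrableOn_min.const_mul (max A B))
    (by fun_prop : Continuous _).aestronglyMeasurable ?_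
  filter_upwards [ae_restrict_mem measurableSet_posPart] with u hu
  set t := ∑ i, u i
  have ht : 0 ≤ t := Finset.sum_nonneg fun i _ => hu.1 i
  rw [Real.norm_of_nonneg (mul_nonneg (monom_nonneg _ hu.1) (Real.exp_pos _).le)]
  have hle : monom (j :: l) u * Real.exp (-ε * t) ≤ t ^ (l.length + 1) * Real.exp (-ε * t) :=
    mul_le_mul_of_nonneg_right (monom_le _ hu.1) (Real.exp_pos _).le
  refine hle.trans ?_
  have hA : t ^ (l.length + 1) * Real.exp (-ε * t) ≤ A := pow_mul_exp_neg_le hε ht _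
  have hB : t ^ l.length * Real.exp (-ε * t) ≤ B := pow_mul_exp_neg_le hε ht _
  rcases le_total 1 t with h | h
  · rw [min_eq_left h, mul_one]
    exact hA.trans (le_max_left _ _)
  · rw [min_eq_right h, pow_succ', mul_assoc, mul_comm (max A B)]
    exact mul_le_mul_of_nonneg_left (hB.trans (le_max_right _ _)) ht

lemma exists_eventually_lt_neg {x : Fin n → ℝ} (hx : x ∈ negOrthant n) :
    ∃ ε > 0, ∀ᶠ s in 𝓝 x, ∀ i, s i < -ε := by
  have h : ∀ᶠ e in 𝓝[>] (0 : ℝ), ∀ i, x i < -e := by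
    refine eventually_all.2 fun i => nhdsWithin_le_nhds ?_
    exact continuous_neg.continuousAt.eventually_const_lt (by simpa using hx i)
  obtain ⟨ε, h, hε⟩ := (h.and self_mem_nhdsWithin).exists
  exact ⟨ε, hε, eventually_all.2 fun i =>
    (continuous_apply i).continuousAt.eventually_lt_const (h i)⟩

lemma sum_mul_le_neg_mul_sum {s u : Fin n → ℝ} {ε : ℝ} (hs : ∀ i, s i < -ε)
    (hu : ∀ i, 0 ≤ u i) : ∑ i, s i * u i ≤ -ε * ∑ i, u i := by
  rw [Finset.mul_sum]
  exact Finset.sum_le_sum fun i _ => mul_le_mul_of_nonneg_right (hs i).le (hu i)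

lemma GoodMeasure.integrableOn_monom_mul_exp {μ : Measure (Fin n → ℝ)} (hμ : GoodMeasure n μ)
    (l : List (Fin n)) (hl : l ≠ []) {s : Fin n → ℝ} (hs : s ∈ negOrthant n) :
    IntegrableOn (fun u => monom l u * Real.exp (∑ i, s i * u i)) (posPart n) μ := by
  obtain ⟨ε, hε, h⟩ := exists_eventually_lt_neg hs
  refine Integrable.mono' (hμ.integrableOn_monom_mul_exp_neg l hl hε)
    (by fun_prop : Continuous _).aestronglyMeasurable ?_
  filter_upwards [ae_restrict_mem measurableSet_posPart] with u hu
  rw [Real.norm_of_nonneg (mul_nonneg (monom_nonneg _ hu.1) (Real.exp_pos _).le)]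
  exact mul_le_mul_of_nonneg_left
    (Real.exp_le_exp.2 (sum_mul_le_neg_mul_sum h.self_of_nhds hu.1)) (monom_nonneg _ hu.1)

lemma GoodMeasure.integrableOn_exp_sub_one {μ : Measure (Fin n → ℝ)} (hμ : GoodMeasure n μ)
    {s : Fin n → ℝ} (hs : s ∈ negOrthant n) :
    IntegrableOn (fun u => Real.exp (∑ i, s i * u i) - 1) (posPart n) μ := by
  refine Integrable.mono' (hμ.integrableOn_min.const_mul (max 1 ‖s‖))
    (by fun_prop : Continuous _).aestronglyMeasurable ?_
  filter_upwards [ae_restrict_mem measurableSet_posPart] with u hu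
  have h0 : ∑ i, s i * u i ≤ 0 :=
    Finset.sum_nonpos fun i _ => mul_nonpos_of_nonpos_of_nonneg (hs i).le (hu.1 i)
  have ht : 0 ≤ ∑ i, u i := Finset.sum_nonneg fun i _ => hu.1 i
  have h1 : -(∑ i, s i * u i) ≤ ‖s‖ * ∑ i, u i := by
    rw [← Finset.sum_neg_distrib, Finset.mul_sum]
    refine Finset.sum_le_sum fun i _ => ?_
    rw [← neg_mul]
    exact mul_le_mul_of_nonneg_right ((neg_le_abs _).trans (norm_le_pi_norm s i)) (hu.1 i)
  rw [Real.norm_of_nonpos (by simpa using h0)]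
  have h2 := Real.add_one_le_exp (∑ i, s i * u i)
  have h3 := Real.exp_pos (∑ i, s i * u i)
  rcases le_total 1 (∑ i, u i) with h | h
  · rw [min_eq_left h]
    linarith [le_max_left 1 ‖s‖]
  · rw [min_eq_right h]
    linarith [mul_le_mul_of_nonneg_right (le_max_right 1 ‖s‖) ht]

/-- The Laplace transform of the measure `∏_{j ∈ l} u_j dμ(u)` on `posPart n`. -/
def laplaceMonom (μ : Measure (Fin n → ℝ)) (l : List (Fin n)) (s : Fin n → ℝ) : ℝ :=
  ∫ u in posPart n, monom l u * Real.exp (∑ i, s i * u i) ∂μ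

lemma laplaceMonom_nonneg (μ : Measure (Fin n → ℝ)) (l : List (Fin n)) (s : Fin n → ℝ) :
    0 ≤ laplaceMonom μ l s :=
  setIntegral_nonneg measurableSet_posPart fun _ hu =>
    mul_nonneg (monom_nonneg l hu.1) (Real.exp_pos _).le

lemma hasFDerivAt_exp_sum (s u : Fin n → ℝ) :
    HasFDerivAt (fun s : Fin n → ℝ => Real.exp (∑ i, s i * u i))
      (∑ j, (u j * Real.exp (∑ i, s i * u i)) •
        (ContinuousLinearMap.proj j : (Fin n → ℝ) →L[ℝ] ℝ)) s := by
  have h : HasFDerivAt (fun s : Fin n → ℝ => ∑ i, s i * u i)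
      (∑ j, u j • (ContinuousLinearMap.proj j : (Fin n → ℝ) →L[ℝ] ℝ)) s :=
    HasFDerivAt.fun_sum fun j _ => (hasFDerivAt_apply j s).mul_const (u j)
  refine h.exp.congr_fderiv ?_
  rw [Finset.smul_sum]
  exact Finset.sum_congr rfl fun j _ => by rw [smul_smul, mul_comm]

/-- Differentiation under the integral sign. The constant `b` covers both the Laplace transforms
(`b = 0`) and the integral of `exp (s·u) - 1` (`l = []`, `b = 1`). -/
lemma GoodMeasure.hasFDerivAt_integral {μ : Measure (Fin n → ℝ)} (hμ : GoodMeasure n μ)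
    (l : List (Fin n)) (b : ℝ) {x : Fin n → ℝ} (hx : x ∈ negOrthant n)
    (hint : IntegrableOn (fun u => monom l u * (Real.exp (∑ i, x i * u i) - b)) (posPart n) μ) :
    HasFDerivAt (fun s => ∫ u in posPart n, monom l u * (Real.exp (∑ i, s i * u i) - b) ∂μ)
      (∑ j, laplaceMonom μ (j :: l) x •
        (ContinuousLinearMap.proj j : (Fin n → ℝ) →L[ℝ] ℝ)) x := by
  obtain ⟨ε, hε, h⟩ := exists_eventually_lt_neg hx
  set F' : (Fin n → ℝ) → (Fin n → ℝ) → ((Fin n → ℝ) →L[ℝ] ℝ) := fun s u =>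
    ∑ j, (monom (j :: l) u * Real.exp (∑ i, s i * u i)) • ContinuousLinearMap.proj j with hF'
  have key := hasFDerivAt_integral_of_dominated_of_fderiv_le (μ := μ.restrict (posPart n))
    (F := fun s u => monom l u * (Real.exp (∑ i, s i * u i) - b)) (F' := F') (x₀ := x)
    (bound := fun u => ∑ j, monom (j :: l) u * Real.exp (-ε * ∑ i, u i)) h
    (Eventually.of_forall fun s => (by fun_prop : Continuous _).aestronglyMeasurable) hint
    (by fun_prop : Continuous (F' x)).aestronglyMeasurable ?_
    (integrable_finsetSum _ fun j _ =>
      hμ.integrableOn_monom_mul_exp_neg (j :: l) (List.cons_ne_nil _ _) hε) ?_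
  · refine key.congr_fderiv ?_
    rw [hF', integral_finsetSum _ fun j _ => (hμ.integrableOn_monom_mul_exp (j :: l)
      (List.cons_ne_nil _ _) hx).smul_const _]
    exact Finset.sum_congr rfl fun j _ => integral_smul_const _ _
  · filter_upwards [ae_restrict_mem measurableSet_posPart] with u hu s hs
    refine norm_sum_le_of_le _ fun j _ => ?_
    rw [norm_smul,
      Real.norm_of_nonneg (mul_nonneg (monom_nonneg _ hu.1) (Real.exp_pos _).le)]
    have hproj : ‖(ContinuousLinearMap.proj j : (Fin n → ℝ) →L[ℝ] ℝ)‖ ≤ 1 :=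
      ContinuousLinearMap.opNorm_le_bound _ zero_le_one fun v => by
        simpa using norm_le_pi_norm v j
    refine (mul_le_of_le_one_right (mul_nonneg (monom_nonneg _ hu.1) (Real.exp_pos _).le)
      hproj).trans ?_
    exact mul_le_mul_of_nonneg_left (Real.exp_le_exp.2 (sum_mul_le_neg_mul_sum hs hu.1))
      (monom_nonneg _ hu.1)
  · refine Eventually.of_forall fun u s _ => ?_
    refine (((hasFDerivAt_exp_sum s u).sub_const b).const_mul (monom l u)).congr_fderiv ?_
    rw [hF', Finset.smul_sum]
    exact Finset.sum_congr rfl fun j _ => by rw [smul_smul, monom_cons]; ring_nf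

lemma GoodMeasure.hasFDerivAt_laplaceMonom {μ : Measure (Fin n → ℝ)} (hμ : GoodMeasure n μ)
    (l : List (Fin n)) (hl : l ≠ []) {x : Fin n → ℝ} (hx : x ∈ negOrthant n) :
    HasFDerivAt (laplaceMonom μ l) (∑ j, laplaceMonom μ (j :: l) x •
      (ContinuousLinearMap.proj j : (Fin n → ℝ) →L[ℝ] ℝ)) x := by
  have h := hμ.hasFDerivAt_integral l 0 hx
    (by simpa only [sub_zero] using hμ.integrableOn_monom_mul_exp l hl hx)
  simp only [sub_zero] at h
  exact h

lemma contDiffOn_succ_of_hasFDerivAt {f : (Fin n → ℝ) → ℝ} {g : Fin n → (Fin n → ℝ) → ℝ} {k : ℕ}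
    (hf : ∀ x ∈ negOrthant n, HasFDerivAt f
      (∑ j, g j x • (ContinuousLinearMap.proj j : (Fin n → ℝ) →L[ℝ] ℝ)) x)
    (hg : ∀ j, ContDiffOn ℝ k (g j) (negOrthant n)) :
    ContDiffOn ℝ (k + 1) f (negOrthant n) := by
  refine (contDiffOn_succ_iff_hasFDerivWithinAt_of_uniqueDiffOn
    isOpen_negOrthant.uniqueDiffOn).2 ⟨by simp, _, ?_, fun x hx => (hf x hx).hasFDerivWithinAt⟩
  exact ContDiffOn.sum fun j _ => (hg j).smul contDiffOn_const

lemma iteratedFDerivWithin_succ_single {f : (Fin n → ℝ) → ℝ} {g : Fin n → (Fin n → ℝ) → ℝ}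
    (hf : ContDiffOn ℝ (⊤ : ℕ∞) f (negOrthant n))
    (hg : ∀ x ∈ negOrthant n, HasFDerivAt f
      (∑ j, g j x • (ContinuousLinearMap.proj j : (Fin n → ℝ) →L[ℝ] ℝ)) x)
    (k : ℕ) (m : Fin (k + 1) → Fin n) {x : Fin n → ℝ} (hx : x ∈ negOrthant n) :
    iteratedFDerivWithin ℝ (k + 1) f (negOrthant n) x (fun i => Pi.single (m i) 1) =
      iteratedFDerivWithin ℝ k (g (m (Fin.last k))) (negOrthant n) x
        (fun i => Pi.single (m i.castSucc) 1) := by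
  have hS : UniqueDiffOn ℝ (negOrthant n) := isOpen_negOrthant.uniqueDiffOn
  set v : Fin n → ℝ := Pi.single (m (Fin.last k)) 1
  have hcongr : EqOn (g (m (Fin.last k)))
      (ContinuousLinearMap.apply ℝ ℝ v ∘ fderivWithin ℝ f (negOrthant n)) (negOrthant n) := by
    intro y hy
    simp [(hg y hy).hasFDerivWithinAt.fderivWithin (hS y hy), v, Pi.single_apply]
  have hdiff : ContDiffOn ℝ k (fderivWithin ℝ f (negOrthant n)) (negOrthant n) :=
    hf.fderivWithin hS (by exact_mod_cast le_top)
  rw [iteratedFDerivWithin_congr hcongr hx, iteratedFDerivWithin_succ_apply_right hS hx,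
    ContinuousLinearMap.iteratedFDerivWithin_comp_left _ (hdiff x hx) hS hx le_rfl]
  rfl

lemma GoodMeasure.contDiffOn_laplaceMonom {μ : Measure (Fin n → ℝ)} (hμ : GoodMeasure n μ)
    (l : List (Fin n)) (hl : l ≠ []) (k : ℕ) :
    ContDiffOn ℝ k (laplaceMonom μ l) (negOrthant n) := by
  induction k generalizing l with
  | zero =>
    exact contDiffOn_zero.2 fun x hx =>
      (hμ.hasFDerivAt_laplaceMonom l hl hx).continuousAt.continuousWithinAt
  | succ k ih =>
    exact contDiffOn_succ_of_hasFDerivAt (fun x hx => hμ.hasFDerivAt_laplaceMonom l hl hx)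
      fun j => ih (j :: l) (List.cons_ne_nil _ _)

lemma GoodMeasure.absMono_const_add_laplaceMonom {μ : Measure (Fin n → ℝ)}
    (hμ : GoodMeasure n μ) (l : List (Fin n)) (hl : l ≠ []) {c : ℝ} (hc : 0 ≤ c) :
    AbsMono n (fun s => c + laplaceMonom μ l s) := by
  have hsmooth : ∀ (l : List (Fin n)) (c : ℝ), l ≠ [] →
      ContDiffOn ℝ (⊤ : ℕ∞) (fun s => c + laplaceMonom μ l s) (negOrthant n) := fun l c hl =>
    contDiffOn_const.add (contDiffOn_infty.2 fun k => hμ.contDiffOn_laplaceMonom l hl k)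
  refine ⟨hsmooth l c hl, fun k => ?_⟩
  induction k generalizing l c with
  | zero => exact fun m x _ => add_nonneg hc (laplaceMonom_nonneg μ l x)
  | succ k ih =>
    intro m x hx
    rw [iteratedFDerivWithin_succ_single (g := fun j s => 0 + laplaceMonom μ (j :: l) s)
      (hsmooth l c hl) (fun y hy => by
        simpa only [zero_add] using (hμ.hasFDerivAt_laplaceMonom l hl hy).const_add c) k m hx]
    exact ih _ (List.cons_ne_nil _ _) le_rfl _ x hx

end

/-- conversely, given `c₀ ≤ 0`, `c₁ ∈ ℝ₊ⁿ` and a measure `μ`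
satisfying the integrability conditions, the formula
`ψ(s) = c₀ + c₁·s + ∫_{ℝ₊ⁿ∖{0}} (e^{s·u} − 1) dμ(u)` is well defined on
`(−∞,0)ⁿ` (the integral converges) and defines a function of class `T_n`. -/
theorem bernstein_of_integral_representation (n : ℕ) (c₀ : ℝ) (hc₀ : c₀ ≤ 0)
    (c₁ : Fin n → ℝ) (hc₁ : ∀ j, 0 ≤ c₁ j)
    (μ : Measure (Fin n → ℝ)) (hμ : GoodMeasure n μ) :
    (∀ s ∈ negOrthant n,
      IntegrableOn (fun u => Real.exp (∑ i, s i * u i) - 1) (posPart n) μ) ∧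
    MemT n (fun s => c₀ + ∑ j, c₁ j * s j +
      ∫ u in posPart n, (Real.exp (∑ i, s i * u i) - 1) ∂μ) := by
  refine ⟨fun s hs => hμ.integrableOn_exp_sub_one hs, ?_⟩
  have hderiv : ∀ x ∈ negOrthant n, HasFDerivAt (fun s => c₀ + ∑ j, c₁ j * s j +
      ∫ u in posPart n, (Real.exp (∑ i, s i * u i) - 1) ∂μ)
      (∑ j, (c₁ j + laplaceMonom μ [j] x) •
        (ContinuousLinearMap.proj j : (Fin n → ℝ) →L[ℝ] ℝ)) x := by
    intro x hx
    have hint := hμ.hasFDerivAt_integral [] 1 hx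
      (by simpa only [monom_nil, one_mul] using hμ.integrableOn_exp_sub_one hx)
    simp only [monom_nil, one_mul] at hint
    have hlin : HasFDerivAt (fun s : Fin n → ℝ => ∑ j, c₁ j * s j)
        (∑ j, c₁ j • (ContinuousLinearMap.proj j : (Fin n → ℝ) →L[ℝ] ℝ)) x :=
      HasFDerivAt.fun_sum fun j _ => (hasFDerivAt_apply j x).const_mul (c₁ j)
    exact ((hlin.const_add c₀).add hint).congr_fderiv
      (by simp only [add_smul, Finset.sum_add_distrib])
  have habs : ∀ j, AbsMono n (fun s => c₁ j + laplaceMonom μ [j] s) := fun j =>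
    hμ.absMono_const_add_laplaceMonom [j] (List.cons_ne_nil _ _) (hc₁ j)
  have hsmooth : ContDiffOn ℝ (⊤ : ℕ∞) (fun s => c₀ + ∑ j, c₁ j * s j +
      ∫ u in posPart n, (Real.exp (∑ i, s i * u i) - 1) ∂μ) (negOrthant n) :=
    contDiffOn_infty.2 fun k => (contDiffOn_succ_of_hasFDerivAt hderiv fun j =>
      contDiffOn_infty.1 (habs j).1 k).of_le (by exact_mod_cast k.le_succ)
  refine ⟨hsmooth, fun x hx => ?_, fun k m x hx => ?_⟩
  · refine add_nonpos (add_nonpos hc₀ ?_) (setIntegral_nonpos measurableSet_posPart fun u hu => ?_)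
    · exact Finset.sum_nonpos fun j _ => mul_nonpos_of_nonneg_of_nonpos (hc₁ j) (hx j).le
    · rw [sub_nonpos, Real.exp_le_one_iff]
      exact Finset.sum_nonpos fun i _ => mul_nonpos_of_nonpos_of_nonneg (hx i).le (hu.1 i)
  · rw [iteratedFDerivWithin_succ_single (g := fun j s => c₁ j + laplaceMonom μ [j] s)
      hsmooth hderiv k m hx]
    exact (habs _).2 k _ x hx
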